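/- arXiv:2604.25211 — 5 statements merged into one kernel-verified Lean document; each statement's English description precedes it below -/
import Mathlib

section
/- Fix integers k ≥ 2 and n ≥ 1. Let Q be a finite directed graph with vertex set V, all mixed-walk directed distances finite, admitting a coloring c : V → ℤ/kℤ, and let z₁,…,zₙ ∈ V be labels. Then for every k-element subset I ⊆ {1,…,n}, the Fermat–Le distance sum satisfies the congruence Σ_Q(I) ≡ Σ_{i∈I} c(z_i) in ℤ/kℤ. In particular, if c̃(z_i) ∈ {0,1,…,k−1} denotes the integer representative of c(z_i) and π_I := −(1/k)·Σ_Q(I), then π_I + (1/k)·Σ_{i∈I} c̃(z_i) is an integer. -/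
/-- `MixedWalk k A v w ℓ` : there is a mixed walk from `v` to `w` of total cost `ℓ`,
where each step traverses an arrow of `A` either forwards at cost `1` or backwards at
cost `k - 1`. -/
inductive MixedWalk {V : Type*} (k : ℕ) (A : V → V → Prop) : V → V → ℕ → Prop
  | nil (v : V) : MixedWalk k A v v 0
  | fwd {v w x : V} {ℓ : ℕ} : A v w → MixedWalk k A w x ℓ → MixedWalk k A v x (ℓ + 1)
  | bwd {v w x : V} {ℓ : ℕ} : A w v → MixedWalk k A w x ℓ → MixedWalk k A v x (ℓ + (k - 1))

/-- A coloring of a directed graph: `c(w) = c(v) + 1` along every arrow `v → w`. -/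
def IsColoring {V : Type*} (k : ℕ) (A : V → V → Prop) (c : V → ZMod k) : Prop :=
  ∀ v w : V, A v w → c w = c v + 1

theorem mixedWalk_color {V : Type*} {k : ℕ} (hk : 2 ≤ k) {A : V → V → Prop}
    {c : V → ZMod k} (hc : IsColoring k A c) {v w : V} {l : ℕ} (h : MixedWalk k A v w l) :
    (l : ZMod k) = c w - c v := by
  induction h with
  | nil v => simp
  | fwd h _ ih => push_cast; rw [ih, hc _ _ h]; ring
  | bwd h _ ih =>
    rw [Nat.cast_add, ih, hc _ _ h, Nat.cast_sub (by omega)]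
    simp
    ring

/-- For a finite directed graph with a coloring `c : V → ℤ/kℤ` and all directed distances
finite, the Fermat–Le distance sum of a `k`-subset `I` is congruent to `Σ_{i∈I} c(z_i)`
modulo `k`; in particular, `π_I + (1/k)·Σ_{i∈I} c̃(z_i)` is an integer, where
`π_I := -(1/k)·Σ_Q(I)` and `c̃` is the integer representative in `{0,…,k−1}`. -/
theorem stmt_2 (k n : ℕ) (hk : 2 ≤ k) (hn : 1 ≤ n)
    {V : Type} [Fintype V] [Nonempty V]
    (A : V → V → Prop)
    (c : V → ZMod k) (hc : IsColoring k A c)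
    (δ : V → V → ℕ)
    (hδ : ∀ v w : V, IsLeast {ℓ : ℕ | MixedWalk k A v w ℓ} (δ v w))
    (z : Fin n → V) :
    ∀ I : Finset (Fin n), I.card = k →
      (((Finset.univ.inf' Finset.univ_nonempty (fun x : V => ∑ i ∈ I, δ x (z i)) : ℕ) :
          ZMod k) = ∑ i ∈ I, c (z i)) ∧
      ∃ m : ℤ,
        -(1 / (k : ℝ)) *
            ((Finset.univ.inf' Finset.univ_nonempty (fun x : V => ∑ i ∈ I, δ x (z i)) : ℕ) : ℝ)
          + (1 / (k : ℝ)) * (∑ i ∈ I, ((c (z i)).val : ℝ)) = (m : ℝ) := by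
  intro I hI
  obtain ⟨x, -, hx⟩ := Finset.exists_mem_eq_inf' (Finset.univ_nonempty (α := V))
    (fun x : V => ∑ i ∈ I, δ x (z i))
  have h1 : ((∑ i ∈ I, δ x (z i) : ℕ) : ZMod k) = ∑ i ∈ I, c (z i) := by
    rw [Nat.cast_sum, Finset.sum_congr rfl (fun i _ => mixedWalk_color hk hc (hδ x (z i)).1),
      Finset.sum_sub_distrib]
    simp [hI]
  rw [hx]
  refine ⟨h1, ?_⟩
  have : NeZero k := ⟨by omega⟩
  have h2 : (((∑ i ∈ I, ((c (z i)).val : ℤ)) - (∑ i ∈ I, δ x (z i) : ℕ) : ℤ) : ZMod k) = 0 := by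
    rw [Int.cast_sub, Int.cast_natCast, h1]
    simp
  obtain ⟨m, hm⟩ := (ZMod.intCast_zmod_eq_zero_iff_dvd _ k).1 h2
  refine ⟨m, ?_⟩
  have h3 := congrArg (Int.cast : ℤ → ℝ) hm
  have hk0 : (k : ℝ) ≠ 0 := by exact_mod_cast (NeZero.ne k)
  push_cast at h3 ⊢
  field_simp
  linarith
end

section
/- Let V be a finite set, B ⊆ V a subset (the boundary vertices), deg : V → ℕ a function, and E, F natural numbers, satisfying: (i) Σ_{v∈V} deg(v) = 2E; (ii) 3(F − 1) = 2E − |B|; (iii) |V| − E + F = 2; (iv) deg(v) ≥ 6 for every v ∉ B. Then Σ_{x∈B} max(4 − deg(x), 0) ≥ 6. -/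
/-- Discrete Gauss–Bonnet inequality. Given abstract combinatorial data: a finite vertex
set `V`, a boundary subset `B ⊆ V`, a degree function `deg`, and numbers `E` (edges) and
`F` (faces) satisfying (i) the handshake identity `Σ deg = 2E`, (ii) the triangular-face
count `3(F − 1) = 2E − |B|`, (iii) Euler's formula `|V| − E + F = 2`, and (iv) `deg ≥ 6`
on interior vertices, we have `Σ_{x∈B} max(4 − deg(x), 0) ≥ 6`. -/
theorem stmt_11 {α : Type} [DecidableEq α] (V B : Finset α) (hBV : B ⊆ V)
    (deg : α → ℕ) (E F : ℕ)
    (h1 : ∑ v ∈ V, deg v = 2 * E)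
    (h2 : 3 * ((F : ℤ) - 1) = 2 * (E : ℤ) - (B.card : ℤ))
    (h3 : (V.card : ℤ) - (E : ℤ) + (F : ℤ) = 2)
    (h4 : ∀ v ∈ V, v ∉ B → 6 ≤ deg v) :
    6 ≤ ∑ x ∈ B, max (4 - (deg x : ℤ)) 0 := by
  have hs := Finset.sum_sdiff (f := deg) hBV
  have hc := Finset.card_sdiff_add_card_eq_card hBV
  have hi : (V \ B).card * 6 ≤ ∑ v ∈ V \ B, deg v := by
    have := Finset.card_nsmul_le_sum (V \ B) deg 6 (fun v hv => by
      rw [Finset.mem_sdiff] at hv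
      exact h4 v hv.1 hv.2)
    simpa using this
  have hb : ∑ x ∈ B, (4 - (deg x : ℤ)) ≤ ∑ x ∈ B, max (4 - (deg x : ℤ)) 0 :=
    Finset.sum_le_sum (fun x _ => le_max_left _ _)
  have he : ∑ x ∈ B, (4 - (deg x : ℤ)) = 4 * (B.card : ℤ) - ((∑ x ∈ B, deg x : ℕ) : ℤ) := by
    rw [Finset.sum_sub_distrib]
    simp [mul_comm]
  rw [he] at hb
  refine le_trans ?_ hb
  omega
end

section
/- Fix an integer n ≥ 3 and the vectors t_J as defined. If 1 ≤ a < a' < b < b' < c < c' ≤ n, then t_{a,b,c} + t_{a',b',c'} = t_{a,b,c'} + t_{a',b',c} = t_{a',b,c} + t_{a,b',c'} = t_{a,b',c} + t_{a',b,c'}. -/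
/-- The vector `t_{a,b,c}`, with entries indexed by pairs (row, column): row `1` is the
indicator of the integer interval `[a, b−2]` and row `2` is the indicator of the integer
interval `[b−1, c−3]`; all other entries are `0`. -/
def tvec (a b c : ℤ) : ℤ × ℤ → ℤ := fun p =>
  (if p.1 = 1 ∧ a ≤ p.2 ∧ p.2 ≤ b - 2 then 1 else 0) +
  (if p.1 = 2 ∧ b - 1 ≤ p.2 ∧ p.2 ≤ c - 3 then 1 else 0)

theorem tvec_split (a b c : ℤ) (h : a < b) (h' : b < c) (r x : ℤ) :
    tvec a b c (r, x) = (if r = 1 ∧ a ≤ x then 1 else 0) +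
      ((if r = 2 ∧ b - 1 ≤ x then 1 else 0) - (if r = 1 ∧ b - 1 ≤ x then 1 else 0)) -
      (if r = 2 ∧ c - 2 ≤ x then 1 else 0) := by
  unfold tvec
  dsimp only
  split_ifs <;> omega

/-- If `1 ≤ a < a' < b < b' < c < c' ≤ n`, then
`t_{a,b,c} + t_{a',b',c'} = t_{a,b,c'} + t_{a',b',c} = t_{a',b,c} + t_{a,b',c'}
= t_{a,b',c} + t_{a',b,c'}`. -/
theorem stmt_13 (n : ℤ) (hn : 3 ≤ n) (a a' b b' c c' : ℤ)
    (h0 : 1 ≤ a) (h1 : a < a') (h2 : a' < b) (h3 : b < b') (h4 : b' < c) (h5 : c < c')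
    (h6 : c' ≤ n) :
    tvec a b c + tvec a' b' c' = tvec a b c' + tvec a' b' c ∧
    tvec a b c' + tvec a' b' c = tvec a' b c + tvec a b' c' ∧
    tvec a' b c + tvec a b' c' = tvec a b' c + tvec a' b c' := by
  refine ⟨?_, ?_, ?_⟩ <;> funext ⟨r, x⟩ <;> simp only [Pi.add_apply] <;>
    rw [tvec_split _ _ _ (by omega) (by omega), tvec_split _ _ _ (by omega) (by omega),
      tvec_split _ _ _ (by omega) (by omega), tvec_split _ _ _ (by omega) (by omega)] <;>
    ring
end

section
/- Fix integers n ≥ 1 and r ≥ 0. The map Ψ, which sends a noncrossing tableau consisting of r triples with entries in {1,…,n} to the 3×r array whose m-th row (m = 1,2,3) is the weakly increasing rearrangement of the multiset of m-th coordinates of the r triples, is a bijection from the set of noncrossing tableaux of r triples with entries in {1,…,n} onto the set of semistandard Young tableaux of rectangular shape 3×r with entries in {1,…,n}, i.e. 3×r arrays whose rows are weakly increasing from left to right and whose columns are strictly increasing from top to bottom. -/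
/-- Two pairs `(a,b)` and `(a',b')` (with `a < b`, `a' < b'`) cross if
`a < a' < b < b'` or `a' < a < b' < b`. -/
def Crosses (e e' : ℕ × ℕ) : Prop :=
  (e.1 < e'.1 ∧ e'.1 < e.2 ∧ e.2 < e'.2) ∨ (e'.1 < e.1 ∧ e.1 < e'.2 ∧ e'.2 < e.2)

/-- Two strictly increasing triples `(a,b,c)` and `(a',b',c')` are noncrossing:
`(a,b),(a',b')` do not cross, `(b,c),(b',c')` do not cross, and if `b = b'` then also
`(a,c),(a',c')` do not cross. -/
def NoncrossingTriples (t t' : ℕ × ℕ × ℕ) : Prop :=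
  ¬ Crosses (t.1, t.2.1) (t'.1, t'.2.1) ∧
  ¬ Crosses (t.2.1, t.2.2) (t'.2.1, t'.2.2) ∧
  (t.2.1 = t'.2.1 → ¬ Crosses (t.1, t.2.2) (t'.1, t'.2.2))

/-- A strictly increasing triple with entries in `{1,…,n}`. -/
def IsIncTriple (n : ℕ) (t : ℕ × ℕ × ℕ) : Prop :=
  1 ≤ t.1 ∧ t.1 < t.2.1 ∧ t.2.1 < t.2.2 ∧ t.2.2 ≤ n

/-- A noncrossing tableau with entries in `{1,…,n}`: a finite multiset of strictly
increasing triples, any two of which (including two copies of the same triple) are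
noncrossing. -/
def IsNCTableau (n : ℕ) (M : Multiset (ℕ × ℕ × ℕ)) : Prop :=
  (∀ t ∈ M, IsIncTriple n t) ∧ (∀ t ∈ M, ∀ t' ∈ M, NoncrossingTriples t t')

/-- The `m`-th coordinate (for `m = 0,1,2`) of a triple. -/
def coordOf (m : Fin 3) (t : ℕ × ℕ × ℕ) : ℕ :=
  if m = 0 then t.1 else if m = 1 then t.2.1 else t.2.2

/-- The map `Ψ` sending a multiset of `r` triples to the `3 × r` array whose `m`-th row
is the weakly increasing rearrangement of the multiset of `m`-th coordinates. -/
def psiMap (r : ℕ) (M : Multiset (ℕ × ℕ × ℕ)) : Fin 3 → Fin r → ℕ :=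
  fun m i => ((M.map (coordOf m)).sort (· ≤ ·)).getD (i : ℕ) 0

/-- A semistandard Young tableau of rectangular shape `3 × r` with entries in `{1,…,n}`:
rows weakly increasing from left to right, columns strictly increasing from top to
bottom. -/
def IsSSYT (n r : ℕ) (T : Fin 3 → Fin r → ℕ) : Prop :=
  (∀ m : Fin 3, ∀ i : Fin r, 1 ≤ T m i ∧ T m i ≤ n) ∧
  (∀ m : Fin 3, ∀ i j : Fin r, i ≤ j → T m i ≤ T m j) ∧
  (∀ i : Fin r, T 0 i < T 1 i ∧ T 1 i < T 2 i)


def DomAB (A B : Multiset ℕ) : Prop :=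
  ∀ v, B.countP (· ≤ v) ≤ A.countP (· < v)

def GoodP (P : Multiset (ℕ × ℕ)) : Prop :=
  (∀ p ∈ P, p.1 < p.2) ∧ (∀ p ∈ P, ∀ q ∈ P, ¬ Crosses p q)

lemma exists_max_ms (A : Multiset ℕ) (h : A ≠ 0) : ∃ a ∈ A, ∀ x ∈ A, x ≤ a := by
  obtain ⟨a, ha, h2⟩ := Finset.exists_max_image A.toFinset id
    (by simpa [Finset.nonempty_iff_ne_empty] using h)
  exact ⟨a, by simpa using ha, fun x hx => h2 x (by simpa using hx)⟩

lemma exists_min_gt (B : Multiset ℕ) (a : ℕ) (h : ∃ b ∈ B, a < b) :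
    ∃ b ∈ B, a < b ∧ ∀ x ∈ B, a < x → b ≤ x := by
  classical
  have h' : ∃ b, b ∈ B ∧ a < b := h
  refine ⟨Nat.find h', (Nat.find_spec h').1, (Nat.find_spec h').2, ?_⟩
  intro x hx hax
  exact Nat.find_min' h' ⟨hx, hax⟩

lemma pair_unique (k : ℕ) : ∀ P P' : Multiset (ℕ × ℕ), P.card = k → GoodP P → GoodP P' →
    P.map Prod.fst = P'.map Prod.fst → P.map Prod.snd = P'.map Prod.snd → P = P' := by
  induction k with
  | zero =>
    intro P P' hk _ _ h1 _
    have : P = 0 := Multiset.card_eq_zero.1 hk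
    subst this
    have := congrArg Multiset.card h1
    simp at this
    exact (Multiset.card_eq_zero.1 this.symm).symm
  | succ k ih =>
    intro P P' hk hP hP' h1 h2
    have hne : P.map Prod.fst ≠ 0 := by
      intro h
      have := congrArg Multiset.card h
      simp [hk] at this
    obtain ⟨a, ha, hmax⟩ := exists_max_ms _ hne
    have hex : ∃ b ∈ P.map Prod.snd, a < b := by
      obtain ⟨p, hp, rfl⟩ := Multiset.mem_map.1 ha
      exact ⟨p.2, Multiset.mem_map_of_mem _ hp, hP.1 p hp⟩
    obtain ⟨b, hb, hab, hmin⟩ := exists_min_gt _ _ hex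
    have key : ∀ R : Multiset (ℕ × ℕ), GoodP R → R.map Prod.fst = P.map Prod.fst →
        R.map Prod.snd = P.map Prod.snd → (a, b) ∈ R := by
      intro R hR e1 e2
      rw [← e1] at ha hmax
      rw [← e2] at hb hmin
      obtain ⟨⟨a1, b1⟩, hp, h⟩ := Multiset.mem_map.1 ha
      obtain ⟨⟨a2, b2⟩, hq, h'⟩ := Multiset.mem_map.1 hb
      simp only at h h'
      subst h h'
      have m1 := hmax _ (Multiset.mem_map_of_mem _ hq)
      have m2 := hmin _ (Multiset.mem_map_of_mem _ hp) (hR.1 _ hp)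
      have m3 := hR.2 _ hp _ hq
      simp only [Crosses] at m1 m2 m3
      by_cases e : a2 = a1
      · subst e; exact hq
      · have : b2 = b1 := by omega
        subst this; exact hp
    obtain ⟨R, rfl⟩ := Multiset.exists_cons_of_mem (key P hP rfl rfl)
    obtain ⟨R', rfl⟩ := Multiset.exists_cons_of_mem (key P' hP' h1.symm h2.symm)
    congr 1
    apply ih
    · simpa using hk
    · exact ⟨fun p hp => hP.1 p (Multiset.mem_cons_of_mem hp), fun p hp q hq =>
        hP.2 p (Multiset.mem_cons_of_mem hp) q (Multiset.mem_cons_of_mem hq)⟩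
    · exact ⟨fun p hp => hP'.1 p (Multiset.mem_cons_of_mem hp), fun p hp q hq =>
        hP'.2 p (Multiset.mem_cons_of_mem hp) q (Multiset.mem_cons_of_mem hq)⟩
    · simpa using h1
    · simpa using h2

lemma pair_exists (k : ℕ) : ∀ A B : Multiset ℕ, A.card = k → B.card = k → DomAB A B →
    ∃ P, GoodP P ∧ P.map Prod.fst = A ∧ P.map Prod.snd = B := by
  induction k with
  | zero =>
    intro A B hA hB _
    rw [Multiset.card_eq_zero] at hA hB
    subst hA hB
    exact ⟨0, by simp [GoodP], by simp, by simp⟩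
  | succ k ih =>
    intro A B hA hB hD
    obtain ⟨a, ha, hmax⟩ := exists_max_ms A (by rintro rfl; simp at hA)
    obtain ⟨A', rfl⟩ := Multiset.exists_cons_of_mem ha
    have hcA : A'.card = k := by simpa using hA
    have hDa : B.countP (· ≤ a) ≤ k := by
      refine (hD a).trans ?_
      rw [Multiset.countP_cons_of_neg _ (by simp), ← hcA]
      exact Multiset.countP_le_card _ _
    have hex : ∃ b ∈ B, a < b := by
      by_contra! h
      have := Multiset.countP_eq_card.2 h
      omega
    obtain ⟨b, hb, hab, hmin⟩ := exists_min_gt _ _ hex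
    obtain ⟨B', rfl⟩ := Multiset.exists_cons_of_mem hb
    have hcB : B'.card = k := by simpa using hB
    obtain ⟨P, hP, e1, e2⟩ := ih A' B' hcA hcB (by
      intro v
      have hv := hD v
      simp only [Multiset.countP_cons] at hv
      by_cases h1 : a < v
      · by_cases h2 : b ≤ v
        · simpa [h1, h2] using hv
        · have : A'.countP (· < v) = A'.card := Multiset.countP_eq_card.2 (fun x hx =>
            lt_of_le_of_lt (hmax x (Multiset.mem_cons_of_mem hx)) h1)
          rw [this, ← hcB.trans hcA.symm]
          exact Multiset.countP_le_card _ _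
      · have h2 : ¬ b ≤ v := by omega
        simpa [h1, h2] using hv)
    refine ⟨(a, b) ::ₘ P, ⟨?_, ?_⟩, by simp [e1], by simp [e2]⟩
    · intro p hp
      rcases Multiset.mem_cons.1 hp with rfl | hp
      · exact hab
      · exact hP.1 p hp
    · have hc : ∀ q ∈ P, q.1 ≤ a ∧ (a < q.2 → b ≤ q.2) := by
        intro q hq
        refine ⟨hmax _ (Multiset.mem_cons_of_mem ?_), hmin _ (Multiset.mem_cons_of_mem ?_)⟩
        · rw [← e1]; exact Multiset.mem_map_of_mem _ hq
        · rw [← e2]; exact Multiset.mem_map_of_mem _ hq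
      intro p hp q hq
      rcases Multiset.mem_cons.1 hp with rfl | hp <;> rcases Multiset.mem_cons.1 hq with rfl | hq
      · simp only [Crosses]; omega
      · have := hc q hq
        simp only [Crosses]; omega
      · have := hc p hp
        simp only [Crosses]; omega
      · exact hP.2 p hp q hq

def pr1 (t : ℕ × ℕ × ℕ) : ℕ × ℕ := (t.1, t.2.1)
def pr2 (t : ℕ × ℕ × ℕ) : ℕ × ℕ := (t.2.1, t.2.2)

def le1 (p q : ℕ × ℕ) : Prop := p.2 < q.2 ∨ (p.2 = q.2 ∧ q.1 ≤ p.1)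
def le2 (p q : ℕ × ℕ) : Prop := p.1 < q.1 ∨ (p.1 = q.1 ∧ p.2 ≤ q.2)
def le3 (s t : ℕ × ℕ × ℕ) : Prop :=
  s.2.1 < t.2.1 ∨ (s.2.1 = t.2.1 ∧ (t.1 < s.1 ∨ (s.1 = t.1 ∧ s.2.2 ≤ t.2.2)))

lemma sort_exists {α : Type} (r : α → α → Prop) (ht : ∀ a b c, r a b → r b c → r a c)
    (ha : ∀ a b, r a b → r b a → a = b) (hto : ∀ a b, r a b ∨ r b a) (M : Multiset α) :
    ∃ L : List α, (L : Multiset α) = M ∧ L.Pairwise r := by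
  classical
  have : IsTrans α r := ⟨ht⟩
  have : Std.Antisymm r := ⟨ha⟩
  have : Std.Total r := ⟨hto⟩
  exact ⟨M.sort r, Multiset.sort_eq _ _, Multiset.pairwise_sort _ _⟩

lemma sort_unique {α : Type} (r : α → α → Prop)
    (ha : ∀ a b, r a b → r b a → a = b) (L L' : List α) (h : L.Pairwise r) (h' : L'.Pairwise r)
    (e : (L : Multiset α) = L') : L = L' :=
  List.Perm.eq_of_pairwise (fun a b _ _ => ha a b) h h' (Multiset.coe_eq_coe.1 e)

lemma le1_anti (p q : ℕ × ℕ) : le1 p q → le1 q p → p = q := by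
  unfold le1; intro h h'; ext <;> omega
lemma le2_anti (p q : ℕ × ℕ) : le2 p q → le2 q p → p = q := by
  unfold le2; intro h h'; ext <;> omega

def Anti (M : Multiset (ℕ × ℕ × ℕ)) : Prop :=
  ∀ s ∈ M, ∀ t ∈ M, s.2.1 = t.2.1 → t.1 < s.1 → s.2.2 ≤ t.2.2

lemma anti_sorted (M : Multiset (ℕ × ℕ × ℕ)) (h : Anti M) :
    ∃ L : List (ℕ × ℕ × ℕ), (L : Multiset _) = M ∧ (L.map pr1).Pairwise le1 ∧
      (L.map pr2).Pairwise le2 := by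
  obtain ⟨L, rfl, hL⟩ := sort_exists le3
    (by unfold le3; intros; omega)
    (by
      rintro ⟨a, b, c⟩ ⟨a', b', c'⟩ h h'
      simp only [le3] at h h'
      simp only [Prod.mk.injEq]; omega)
    (by unfold le3; intros; omega) M
  refine ⟨L, rfl, ?_, ?_⟩
  · rw [List.pairwise_map]
    refine hL.imp ?_
    intro s t hst
    simp only [le3, le1, pr1] at *
    omega
  · rw [List.pairwise_map]
    refine hL.imp_of_mem ?_
    intro s t hs ht hst
    have := h s (by simpa using hs) t (by simpa using ht)
    simp only [le3, le2, pr2] at *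
    omega

lemma list_det : ∀ L L' : List (ℕ × ℕ × ℕ), L.map pr1 = L'.map pr1 → L.map pr2 = L'.map pr2 →
    L = L' := by
  intro L
  induction L with
  | nil => intro L' h _; cases L' <;> simp_all
  | cons t L ih =>
    intro L' h h'
    cases L' with
    | nil => simp at h
    | cons t' L' =>
      simp only [List.map_cons, List.cons.injEq] at h h'
      rw [ih L' h.2 h'.2]
      obtain ⟨a, b, c⟩ := t
      obtain ⟨a', b', c'⟩ := t'
      simp only [pr1, pr2, Prod.mk.injEq] at h h'
      simp [h.1.1, h'.1.1, h'.1.2]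

lemma list_glue : ∀ p q : List (ℕ × ℕ), p.map Prod.snd = q.map Prod.fst →
    ∃ L : List (ℕ × ℕ × ℕ), L.map pr1 = p ∧ L.map pr2 = q := by
  intro p
  induction p with
  | nil => intro q h; exact ⟨[], rfl, by cases q <;> simp_all⟩
  | cons x p ih =>
    intro q h
    cases q with
    | nil => simp at h
    | cons y q =>
      simp only [List.map_cons, List.cons.injEq] at h
      obtain ⟨L, h1, h2⟩ := ih q h.2
      exact ⟨(x.1, x.2, y.2) :: L, by simp [pr1, h1], by simp [pr2, h2, h.1]⟩

lemma glue_unique (M M' : Multiset (ℕ × ℕ × ℕ)) (h : Anti M) (h' : Anti M')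
    (e1 : M.map pr1 = M'.map pr1) (e2 : M.map pr2 = M'.map pr2) : M = M' := by
  obtain ⟨L, rfl, a1, a2⟩ := anti_sorted M h
  obtain ⟨L', rfl, b1, b2⟩ := anti_sorted M' h'
  rw [list_det L L' (sort_unique le1 le1_anti _ _ a1 b1 (by simpa using e1))
    (sort_unique le2 le2_anti _ _ a2 b2 (by simpa using e2))]

lemma glue_exists (P Q : Multiset (ℕ × ℕ)) (h : P.map Prod.snd = Q.map Prod.fst) :
    ∃ M : Multiset (ℕ × ℕ × ℕ), M.map pr1 = P ∧ M.map pr2 = Q ∧ Anti M := by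
  obtain ⟨p, rfl, hp⟩ := sort_exists le1 (by unfold le1; intros; omega) le1_anti
    (by unfold le1; intros; omega) P
  obtain ⟨q, rfl, hq⟩ := sort_exists le2 (by unfold le2; intros; omega) le2_anti
    (by unfold le2; intros; omega) Q
  have e : p.map Prod.snd = q.map Prod.fst := by
    refine sort_unique (· ≤ ·) (fun a b => le_antisymm) _ _ ?_ ?_ (by simpa using h)
    · rw [List.pairwise_map]
      exact hp.imp (by unfold le1; intros; omega)
    · rw [List.pairwise_map]
      exact hq.imp (by unfold le2; intros; omega)
  obtain ⟨L, rfl, rfl⟩ := list_glue p q e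
  refine ⟨L, by simp, by simp, ?_⟩
  rw [List.pairwise_map] at hp hq
  have hpq := hp.and hq
  have := hpq.imp (S := fun s t => (s.2.1 = t.2.1 → t.1 < s.1 → s.2.2 ≤ t.2.2) ∧
    (t.2.1 = s.2.1 → s.1 < t.1 → t.2.2 ≤ s.2.2)) (by
      intro s t hst
      simp only [le1, le2, pr1, pr2] at hst
      omega)
  have h2 := @List.Pairwise.forall_of_forall _ _ _ ⟨fun s t hst => ⟨hst.2, hst.1⟩⟩
    (fun s _ => ⟨fun _ hh => absurd hh (lt_irrefl _), fun _ hh => absurd hh (lt_irrefl _)⟩) this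
  intro s hs t ht
  exact (h2 (by simpa using hs) (by simpa using ht)).1

lemma psi_ofFn (r : ℕ) (M : Multiset (ℕ × ℕ × ℕ)) (h : M.card = r) (m : Fin 3) :
    List.ofFn (psiMap r M m) = (M.map (coordOf m)).sort (· ≤ ·) := by
  apply List.ext_getElem
  · simp [h]
  · intro i h1 h2
    simp only [List.getElem_ofFn, psiMap]
    exact List.getD_eq_getElem _ _ h2

lemma psi_ms (r : ℕ) (M : Multiset (ℕ × ℕ × ℕ)) (h : M.card = r) (m : Fin 3) :
    ((List.ofFn (psiMap r M m) : List ℕ) : Multiset ℕ) = M.map (coordOf m) := by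
  rw [psi_ofFn r M h, Multiset.sort_eq]

lemma psi_mono (r : ℕ) (M : Multiset (ℕ × ℕ × ℕ)) (h : M.card = r) (m : Fin 3) :
    (List.ofFn (psiMap r M m)).Pairwise (· ≤ ·) := by
  rw [psi_ofFn r M h]
  exact Multiset.pairwise_sort _ _

lemma mono_iff {r : ℕ} (f : Fin r → ℕ) :
    (List.ofFn f).Pairwise (· ≤ ·) ↔ ∀ i j : Fin r, i ≤ j → f i ≤ f j := by
  rw [List.pairwise_ofFn]
  constructor
  · intro h i j hij
    rcases hij.lt_or_eq with h1 | rfl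
    · exact h h1
    · exact le_rfl
  · intro h i j hij
    exact h i j hij.le

lemma countP_ofFn {r : ℕ} (f : Fin r → ℕ) (p : ℕ → Prop) [DecidablePred p] :
    Multiset.countP p ((List.ofFn f : List ℕ) : Multiset ℕ) =
      (Finset.univ.filter (fun i => p (f i))).card := by
  have : ((List.ofFn f : List ℕ) : Multiset ℕ) = (Finset.univ : Finset (Fin r)).val.map f := by
    simp
  rw [this, Multiset.countP_map]
  rfl

lemma dom_of_lt {r : ℕ} (f g : Fin r → ℕ) (h : ∀ i, f i < g i) :
    DomAB (List.ofFn f : List ℕ) (List.ofFn g : List ℕ) := by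
  intro v
  rw [countP_ofFn, countP_ofFn]
  apply Finset.card_le_card
  intro i
  simp only [Finset.mem_filter, Finset.mem_univ, true_and]
  have := h i
  omega

lemma lt_of_dom {r : ℕ} (f g : Fin r → ℕ) (hf : ∀ i j : Fin r, i ≤ j → f i ≤ f j)
    (hg : ∀ i j : Fin r, i ≤ j → g i ≤ g j)
    (h : DomAB (List.ofFn f : List ℕ) (List.ofFn g : List ℕ)) (i : Fin r) : f i < g i := by
  by_contra! hc
  have hv := h (g i)
  rw [countP_ofFn, countP_ofFn] at hv
  have h1 : (Finset.Iic i).card ≤ (Finset.univ.filter (fun j => g j ≤ g i)).card := by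
    apply Finset.card_le_card
    intro j hj
    simpa using hg j i (by simpa using hj)
  have h2 : (Finset.univ.filter (fun j => f j < g i)).card ≤ (Finset.Iio i).card := by
    apply Finset.card_le_card
    intro j hj
    simp only [Finset.mem_filter, Finset.mem_univ, true_and, Finset.mem_Iio] at hj ⊢
    by_contra! hij
    have := hf i j hij
    omega
  simp at h1 h2
  omega

lemma dom_map {α : Type} (M : Multiset α) (f g : α → ℕ) (h : ∀ t ∈ M, f t < g t) :
    DomAB (M.map f) (M.map g) := by
  intro v
  rw [Multiset.countP_map, Multiset.countP_map]
  apply Multiset.card_le_card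
  rw [Multiset.le_filter]
  refine ⟨Multiset.filter_le _ _, ?_⟩
  intro t ht
  rw [Multiset.mem_filter] at ht
  have := h t ht.1
  omega

lemma nc_good (n : ℕ) (M : Multiset (ℕ × ℕ × ℕ)) (h : IsNCTableau n M) :
    GoodP (M.map pr1) ∧ GoodP (M.map pr2) ∧ Anti M := by
  refine ⟨⟨?_, ?_⟩, ⟨?_, ?_⟩, ?_⟩
  · intro p hp
    obtain ⟨t, ht, rfl⟩ := Multiset.mem_map.1 hp
    exact (h.1 t ht).2.1
  · intro p hp q hq
    obtain ⟨t, ht, rfl⟩ := Multiset.mem_map.1 hp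
    obtain ⟨s, hs, rfl⟩ := Multiset.mem_map.1 hq
    exact (h.2 t ht s hs).1
  · intro p hp
    obtain ⟨t, ht, rfl⟩ := Multiset.mem_map.1 hp
    exact (h.1 t ht).2.2.1
  · intro p hp q hq
    obtain ⟨t, ht, rfl⟩ := Multiset.mem_map.1 hp
    obtain ⟨s, hs, rfl⟩ := Multiset.mem_map.1 hq
    exact (h.2 t ht s hs).2.1
  · intro s hs t ht e hlt
    have h1 := h.1 s hs
    have h2 := h.1 t ht
    have h3 := (h.2 s hs t ht).2.2 e
    simp only [IsIncTriple, Crosses] at h1 h2 h3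
    omega

lemma coord0 : coordOf 0 = Prod.fst ∘ pr1 := by ext t; simp [coordOf, pr1]
lemma coord1 : coordOf 1 = Prod.snd ∘ pr1 := by ext t; simp [coordOf, pr1]
lemma coord1' : coordOf 1 = Prod.fst ∘ pr2 := by ext t; simp [coordOf, pr2]
lemma coord2 : coordOf 2 = Prod.snd ∘ pr2 := by ext t; simp [coordOf, pr2]

/-- The map `Ψ` is a bijection from noncrossing tableaux of `r` triples with entries in
`{1,…,n}` onto semistandard Young tableaux of shape `3 × r` with entries in `{1,…,n}`. -/
theorem stmt_15 (n r : ℕ) (hn : 1 ≤ n) :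
    (∀ M : Multiset (ℕ × ℕ × ℕ), IsNCTableau n M → M.card = r →
      IsSSYT n r (psiMap r M)) ∧
    (∀ M M' : Multiset (ℕ × ℕ × ℕ),
      IsNCTableau n M → M.card = r → IsNCTableau n M' → M'.card = r →
      psiMap r M = psiMap r M' → M = M') ∧
    (∀ T : Fin 3 → Fin r → ℕ, IsSSYT n r T →
      ∃ M : Multiset (ℕ × ℕ × ℕ), IsNCTableau n M ∧ M.card = r ∧ psiMap r M = T) := by
  refine ⟨?_, ?_, ?_⟩
  · intro M hM hr
    have hmono := fun m => (mono_iff _).1 (psi_mono r M hr m)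
    have hdom : ∀ m m' : Fin 3, (∀ t ∈ M, coordOf m t < coordOf m' t) → ∀ i,
        psiMap r M m i < psiMap r M m' i := by
      intro m m' h
      apply lt_of_dom _ _ (hmono m) (hmono m')
      rw [psi_ms r M hr, psi_ms r M hr]
      exact dom_map _ _ _ h
    refine ⟨?_, hmono, fun i => ⟨hdom 0 1 ?_ i, hdom 1 2 ?_ i⟩⟩
    · intro m i
      have : psiMap r M m i ∈ M.map (coordOf m) := by
        rw [← psi_ms r M hr, Multiset.mem_coe, List.mem_ofFn]
        exact ⟨i, rfl⟩
      obtain ⟨t, ht, e⟩ := Multiset.mem_map.1 this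
      rw [← e]
      have := hM.1 t ht
      simp only [IsIncTriple] at this
      unfold coordOf
      split_ifs <;> omega
    · intro t ht
      simpa [coordOf] using (hM.1 t ht).2.1
    · intro t ht
      simpa [coordOf] using (hM.1 t ht).2.2.1
  · intro M M' hM hr hM' hr' e
    have hm : ∀ m, M.map (coordOf m) = M'.map (coordOf m) := by
      intro m
      rw [← psi_ms r M hr, ← psi_ms r M' hr', e]
    obtain ⟨g1, g2, g3⟩ := nc_good n M hM
    obtain ⟨g1', g2', g3'⟩ := nc_good n M' hM'
    refine glue_unique M M' g3 g3' (pair_unique _ _ _ rfl g1 g1' ?_ ?_)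
      (pair_unique _ _ _ rfl g2 g2' ?_ ?_)
    · simpa only [Multiset.map_map, coord0] using hm 0
    · simpa only [Multiset.map_map, coord1] using hm 1
    · simpa only [Multiset.map_map, coord1'] using hm 1
    · simpa only [Multiset.map_map, coord2] using hm 2
  · intro T hT
    obtain ⟨hb, hmono, hlt⟩ := hT
    obtain ⟨P, hP, p1, p2⟩ := pair_exists r _ _ (by simp) (by simp)
      (dom_of_lt (T 0) (T 1) (fun i => (hlt i).1))
    obtain ⟨Q, hQ, q1, q2⟩ := pair_exists r _ _ (by simp) (by simp)
      (dom_of_lt (T 1) (T 2) (fun i => (hlt i).2))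
    obtain ⟨M, rfl, rfl, hA⟩ := glue_exists P Q (p2.trans q1.symm)
    rw [Multiset.map_map] at p1 p2 q1 q2
    rw [← coord0] at p1
    rw [← coord1] at p2
    rw [← coord2] at q2
    have hall : ∀ m, M.map (coordOf m) = ((List.ofFn (T m) : List ℕ) : Multiset ℕ) := by
      intro m
      fin_cases m
      · exact p1
      · exact p2
      · exact q2
    have hcard : M.card = r := by
      have := congrArg Multiset.card p1
      simpa using this
    have hbd : ∀ m, ∀ t ∈ M, 1 ≤ coordOf m t ∧ coordOf m t ≤ n := by
      intro m t ht
      have := Multiset.mem_map_of_mem (coordOf m) ht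
      rw [hall, Multiset.mem_coe, List.mem_ofFn] at this
      obtain ⟨i, hi⟩ := this
      rw [← hi]
      exact hb m i
    refine ⟨M, ⟨?_, ?_⟩, hcard, ?_⟩
    · intro t ht
      have h0 := (hbd 0 t ht).1
      have h2 := (hbd 2 t ht).2
      have h3 := hP.1 _ (Multiset.mem_map_of_mem pr1 ht)
      have h4 := hQ.1 _ (Multiset.mem_map_of_mem pr2 ht)
      rw [coord0] at h0
      rw [coord2] at h2
      exact ⟨h0, h3, h4, h2⟩
    · intro t ht s hs
      refine ⟨hP.2 _ (Multiset.mem_map_of_mem pr1 ht) _ (Multiset.mem_map_of_mem pr1 hs),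
        hQ.2 _ (Multiset.mem_map_of_mem pr2 ht) _ (Multiset.mem_map_of_mem pr2 hs), ?_⟩
      intro e
      have h1 := hA t ht s hs e
      have h2 := hA s hs t ht e.symm
      simp only [Crosses]
      omega
    · funext m
      apply List.ofFn_injective
      refine sort_unique (· ≤ ·) (fun a b => le_antisymm) _ _ (psi_mono r M hcard m)
        ((mono_iff _).2 (hmono m)) ?_
      rw [psi_ms r M hcard, hall]
end

section
/- Let (a < b < c) and (a' < b' < c') be noncrossing triples with entries in {1,…,n}. Regard each triple as contributing a left arc (its first and second coordinates) and a right arc (its second and third coordinates). Then: (1) the left arcs (a,b) and (a',b') do not cross and the right arcs (b,c) and (b',c') do not cross, so any crossing between an arc of the first triple and an arc of the second occurs between the left arc of one and the right arc of the other; (2) at most one of the four arc pairs crosses, i.e. it is not possible that (a,b) crosses (b',c') and simultaneously (b,c) crosses (a',b'). Consequently, among all left and right arcs of the triples of a noncrossing tableau, no three arcs pairwise cross. -/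
/-- `e` is an arc of the triple `t = (a,b,c)`: its left arc `(a,b)` or its right arc
`(b,c)`. -/
def IsArcOf (e : ℕ × ℕ) (t : ℕ × ℕ × ℕ) : Prop :=
  e = (t.1, t.2.1) ∨ e = (t.2.1, t.2.2)

/-- For noncrossing triples `(a,b,c)` and `(a',b',c')`:
(1) the left arcs do not cross and the right arcs do not cross, so any crossing between
an arc of the first triple and an arc of the second occurs between the left arc of one
and the right arc of the other;
(2) it is impossible that `(a,b)` crosses `(b',c')` and simultaneously `(b,c)` crosses
`(a',b')`.
Consequently, among all left and right arcs of the triples of a noncrossing tableau,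
no three arcs pairwise cross. -/
theorem stmt_16 (n : ℕ) (a b c a' b' c' : ℕ)
    (ht : IsIncTriple n (a, b, c)) (ht' : IsIncTriple n (a', b', c'))
    (hnc : NoncrossingTriples (a, b, c) (a', b', c')) :
    (¬ Crosses (a, b) (a', b') ∧ ¬ Crosses (b, c) (b', c')) ∧
    (∀ e e' : ℕ × ℕ, IsArcOf e (a, b, c) → IsArcOf e' (a', b', c') → Crosses e e' →
      (e = (a, b) ∧ e' = (b', c')) ∨ (e = (b, c) ∧ e' = (a', b'))) ∧
    (¬ (Crosses (a, b) (b', c') ∧ Crosses (b, c) (a', b'))) ∧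
    (∀ M : Multiset (ℕ × ℕ × ℕ), IsNCTableau n M →
      ∀ t₁ ∈ M, ∀ t₂ ∈ M, ∀ t₃ ∈ M, ∀ e₁ e₂ e₃ : ℕ × ℕ,
        IsArcOf e₁ t₁ → IsArcOf e₂ t₂ → IsArcOf e₃ t₃ →
        ¬ (Crosses e₁ e₂ ∧ Crosses e₁ e₃ ∧ Crosses e₂ e₃)) := by
  obtain ⟨h1, h2, -⟩ := hnc
  refine ⟨⟨h1, h2⟩, ?_, ?_, ?_⟩
  · intro e e' he he' hc
    rcases he with rfl | rfl <;> rcases he' with rfl | rfl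
    · exact absurd hc h1
    · exact Or.inl ⟨rfl, rfl⟩
    · exact Or.inr ⟨rfl, rfl⟩
    · exact absurd hc h2
  · simp only [Crosses, IsIncTriple] at *
    omega
  · intro M hM t₁ m₁ t₂ m₂ t₃ m₃ e₁ e₂ e₃ he₁ he₂ he₃ ⟨c12, c13, c23⟩
    have n12 := hM.2 t₁ m₁ t₂ m₂
    have n13 := hM.2 t₁ m₁ t₃ m₃
    have n23 := hM.2 t₂ m₂ t₃ m₃
    rcases he₁ with rfl | rfl <;> rcases he₂ with rfl | rfl <;> rcases he₃ with rfl | rfl <;>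
      first
        | exact n12.1 c12
        | exact n12.2.1 c12
        | exact n13.1 c13
        | exact n13.2.1 c13
        | exact n23.1 c23
        | exact n23.2.1 c23
end
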